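/- Let X and Y be real Banach spaces, let L⁻¹ : Y → X be a compact bounded linear operator, and let Q : [0,∞) → 𝓛(Y) be a family of bounded linear operators such that ‖Q(t)‖ ≤ M₀ for all t ≥ 0 and t ↦ Q(t)u is continuous for each u ∈ Y. Fix 0 < α < 1 and define S_α(t)u = ∫₀^∞ ζ_α(θ) L⁻¹ Q(t^α θ) u dθ and T_α(t)u = α ∫₀^∞ θ ζ_α(θ) L⁻¹ Q(t^α θ) u dθ. Then for every t ≥ 0 the operators S_α(t) : Y → X and T_α(t) : Y → X are compact operators. -/

import Mathlib

open MeasureTheory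

/-- The Wright-type function `ϖ_α(θ)` for `0 < α < 1`. -/
noncomputable def wrightFn (α θ : ℝ) : ℝ :=
  (1 / Real.pi) * ∑' n : ℕ,
    (-1 : ℝ) ^ n * θ ^ (-(α * ((n : ℝ) + 1)) - 1) *
      (Real.Gamma (((n : ℝ) + 1) * α + 1) / (Nat.factorial (n + 1) : ℝ)) *
      Real.sin (((n : ℝ) + 1) * Real.pi * α)

/-- The probability density `ζ_α(θ) = (1/α) θ^{-1-1/α} ϖ_α(θ^{-1/α})`. -/
noncomputable def zetaFn (α θ : ℝ) : ℝ :=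
  (1 / α) * θ ^ (-1 - 1 / α) * wrightFn α (θ ^ (-(1 / α)))

open scoped Pointwise in
lemma aux_compact {X Y : Type*} [NormedAddCommGroup X] [NormedSpace ℝ X] [CompleteSpace X]
    [NormedAddCommGroup Y] [NormedSpace ℝ Y]
    (Linv : Y →L[ℝ] X) (hLinv : IsCompactOperator (⇑Linv))
    (Q : ℝ → Y →L[ℝ] Y) (M₀ : ℝ) (hQ : ∀ t, 0 ≤ t → ‖Q t‖ ≤ M₀)
    (f : ℝ → ℝ) (hf : IntegrableOn f (Set.Ioi 0)) (s : ℝ) (hs : 0 ≤ s) :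
    IsCompactOperator
        (fun u : Y => ∫ θ in Set.Ioi (0 : ℝ), f θ • Linv (Q (s * θ) u)) := by
  have hM : 0 ≤ M₀ := (norm_nonneg _).trans (hQ 0 le_rfl)
  set K : Set X := closure (Linv '' Metric.closedBall 0 M₀) with hK
  have hKc : IsCompact K := hLinv.isCompact_closure_image_closedBall (f := (Linv : Y →ₗ[ℝ] X)) M₀
  have hKconv : Convex ℝ K :=
    ((convex_closedBall (0 : Y) M₀).linear_image (Linv : Y →ₗ[ℝ] X)).closure
  have hmem : ∀ y : Y, ‖y‖ ≤ M₀ → Linv y ∈ K := fun y hy =>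
    subset_closure ⟨y, by simpa using hy, rfl⟩
  set m : ℝ := ∫ θ in Set.Ioi (0 : ℝ), |f θ| with hm
  have hm0 : 0 ≤ m := integral_nonneg fun _ => abs_nonneg _
  have h0 : (0 : X) ∈ m • K := by
    refine ⟨0, by simpa using hmem 0 (by simpa using hM), by simp⟩
  refine ⟨m • K, hKc.smul m, Filter.mem_of_superset (Metric.closedBall_mem_nhds 0 one_pos) ?_⟩
  intro u hu
  have hu : ‖u‖ ≤ 1 := by simpa using hu
  have hQu : ∀ θ, 0 < θ → ‖Q (s * θ) u‖ ≤ M₀ := fun θ hθ => by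
    have h1 := hQ (s * θ) (by positivity)
    calc _ ≤ ‖Q (s * θ)‖ * ‖u‖ := (Q (s * θ)).le_opNorm u
      _ ≤ M₀ * 1 := by gcongr
      _ = M₀ := mul_one _
  show (∫ θ in Set.Ioi (0 : ℝ), f θ • Linv (Q (s * θ) u)) ∈ m • K
  by_cases hi : IntegrableOn (fun θ => f θ • Linv (Q (s * θ) u)) (Set.Ioi 0)
  swap
  · rw [integral_undef hi]; exact h0
  rcases hm0.eq_or_lt with hm00 | hmpos
  · have hz : (fun θ => |f θ|) =ᵐ[volume.restrict (Set.Ioi 0)] 0 := by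
      rw [← integral_eq_zero_iff_of_nonneg (fun _ => abs_nonneg _) hf.abs]
      exact hm00.symm
    have : ∫ θ in Set.Ioi (0 : ℝ), f θ • Linv (Q (s * θ) u) = 0 := by
      apply integral_eq_zero_of_ae
      filter_upwards [hz] with θ h
      have : f θ = 0 := by simpa using h
      simp [this]
    rw [this]; exact h0
  by_contra hx
  obtain ⟨l, c, hl1, hl2⟩ := geometric_hahn_banach_closed_point (hKconv.smul m)
    (hKc.smul m).isClosed hx
  have key : m * l (∫ θ in Set.Ioi (0 : ℝ), f θ • Linv (Q (s * θ) u)) ≤ m * c := by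
    rw [← l.integral_comp_comm hi, ← integral_const_mul, hm, ← integral_mul_const]
    refine setIntegral_mono_on ((l.integrable_comp hi).const_mul _) (hf.abs.mul_const _)
      measurableSet_Ioi ?_
    intro θ hθ
    have hθ : 0 < θ := hθ
    have p1 := hl1 _ (Set.smul_mem_smul_set (a := m) (hmem _ (hQu θ hθ)))
    have p2 := hl1 _ (Set.smul_mem_smul_set (a := m)
      (hmem (-(Q (s * θ) u)) (by simpa using hQu θ hθ)))
    simp only [map_smul, map_neg, smul_eq_mul, ← hm] at p1 p2 ⊢
    rcases abs_cases (f θ) with ⟨h, h'⟩ | ⟨h, h'⟩ <;> rw [h] <;> nlinarith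
  have := le_of_mul_le_mul_left key hmpos
  linarith

lemma aux_int (b c : ℝ) (hb : 0 ≤ b) (hc : 0 < c) :
    IntegrableOn (fun t : ℝ => t ^ b * Real.exp (-(c * t))) (Set.Ioi 0) := by
  have := integrableOn_rpow_mul_exp_neg_mul_rpow (p := 1) (s := b) (b := c) (by linarith) one_pos hc
  simpa using this

lemma aux_norm_exp (r : ℂ) (t : ℝ) : ‖Complex.exp (-(r * t))‖ = Real.exp (-(r.re * t)) := by
  rw [Complex.norm_exp]; simp

lemma gamma_rot (b : ℝ) (hb : 0 ≤ b) (r : ℂ) (hr : 0 < r.re) :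
    ∫ t in Set.Ioi (0 : ℝ), ((t ^ b : ℝ) : ℂ) * Complex.exp (-(r * t)) =
      r ^ (-((b : ℂ) + 1)) * (Real.Gamma (b + 1) : ℂ) := by
  set U : Set ℂ := {z : ℂ | 0 < z.re} with hU
  have hUo : IsOpen U := isOpen_lt continuous_const Complex.continuous_re
  have hUc : IsPreconnected U := (convex_halfSpace_re_gt 0).isPreconnected
  have hmeas : ∀ z : ℂ, ∀ b : ℝ, AEStronglyMeasurable
      (fun t : ℝ => ((t ^ b : ℝ) : ℂ) * Complex.exp (-(z * t))) (volume.restrict (Set.Ioi 0)) := by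
    intro z b
    exact (by fun_prop : Measurable fun t : ℝ => ((t ^ b : ℝ) : ℂ) * Complex.exp (-(z * t))).aestronglyMeasurable
  have hd1 : DifferentiableOn ℂ (fun z : ℂ => ∫ t in Set.Ioi (0 : ℝ),
      ((t ^ b : ℝ) : ℂ) * Complex.exp (-(z * t))) U := by
    intro z hz
    have hz : 0 < z.re := hz
    apply DifferentiableAt.differentiableWithinAt
    have hs : {y : ℂ | z.re / 2 < y.re} ∈ nhds z :=
      (isOpen_lt continuous_const Complex.continuous_re).mem_nhds (by simp; linarith)
    refine (hasDerivAt_integral_of_dominated_loc_of_deriv_le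
      (F := fun (z : ℂ) (t : ℝ) => ((t ^ b : ℝ) : ℂ) * Complex.exp (-(z * t)))
      (F' := fun (z : ℂ) (t : ℝ) => ((t ^ b : ℝ) : ℂ) * (Complex.exp (-(z * t)) * (-(t : ℂ))))
      (bound := fun t => t ^ (b + 1) * Real.exp (-(z.re / 2 * t))) hs
      (Filter.Eventually.of_forall fun y => hmeas y b) ?_ ?_ ?_
      (aux_int _ _ (by linarith) (by linarith)) ?_).2.differentiableAt
    · refine (aux_int b z.re hb hz).mono' (hmeas z b) ?_
      filter_upwards [ae_restrict_mem measurableSet_Ioi] with t ht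
      have ht : 0 < t := ht
      rw [norm_mul, aux_norm_exp, Complex.norm_real, Real.norm_of_nonneg (by positivity)]
    · exact (by fun_prop : Measurable fun t : ℝ =>
        ((t ^ b : ℝ) : ℂ) * (Complex.exp (-(z * t)) * (-(t : ℂ)))).aestronglyMeasurable
    · filter_upwards [ae_restrict_mem measurableSet_Ioi] with t ht y hy
      have ht : 0 < t := ht
      have hy : z.re / 2 < y.re := hy
      rw [norm_mul, norm_mul, aux_norm_exp, norm_neg, Complex.norm_real, Complex.norm_real,
        Real.norm_of_nonneg (by positivity), Real.norm_of_nonneg ht.le, Real.rpow_add ht,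
        Real.rpow_one]
      have : Real.exp (-(y.re * t)) ≤ Real.exp (-(z.re / 2 * t)) := by gcongr
      have h2 : 0 ≤ t ^ b * t := by positivity
      nlinarith
    · refine Filter.Eventually.of_forall fun t y _ => ?_
      have h : HasDerivAt (fun y : ℂ => -(y * (t : ℂ))) (-(t : ℂ)) y := by
        simpa using ((hasDerivAt_id y).mul_const (t : ℂ)).fun_neg
      exact h.cexp.const_mul _
  have hd2 : DifferentiableOn ℂ (fun z : ℂ =>
      z ^ (-((b : ℂ) + 1)) * (Real.Gamma (b + 1) : ℂ)) U := by
    intro z hz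
    have hz : 0 < z.re := hz
    apply DifferentiableAt.differentiableWithinAt
    exact (differentiableAt_id.cpow_const (Or.inl hz)).mul_const _
  have := (hd1.analyticOnNhd hUo).eqOn_of_preconnected_of_frequently_eq (hd2.analyticOnNhd hUo)
    hUc (z₀ := 1) (by simp [hU]) ?_
  · exact this hr
  have hreal : ∀ x : ℝ, 0 < x → (∫ t in Set.Ioi (0 : ℝ), ((t ^ b : ℝ) : ℂ) *
      Complex.exp (-((x : ℂ) * t))) = (x : ℂ) ^ (-((b : ℂ) + 1)) * (Real.Gamma (b + 1) : ℂ) := by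
    intro x hx
    have h := Real.integral_rpow_mul_exp_neg_mul_Ioi (a := b + 1) (r := x) (by linarith) hx
    have e : (x : ℂ) ^ (-((b : ℂ) + 1)) = (((1 / x) ^ (b + 1) : ℝ) : ℂ) := by
      rw [one_div, Real.inv_rpow hx.le, ← Real.rpow_neg hx.le, Complex.ofReal_cpow hx.le]
      push_cast; rfl
    rw [e, ← Complex.ofReal_mul, ← h, ← integral_complex_ofReal]
    congr 1
    ext t
    push_cast
    simp
  have ht : Filter.Tendsto (fun x : ℝ => (x : ℂ)) (nhdsWithin 1 {1}ᶜ) (nhdsWithin 1 {1}ᶜ) := by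
    apply tendsto_nhdsWithin_iff.2
    constructor
    · exact (Complex.continuous_ofReal.tendsto' 1 1 (by simp)).mono_left nhdsWithin_le_nhds
    · filter_upwards [self_mem_nhdsWithin] with x hx
      simpa using hx
  refine ht.frequently (Filter.Eventually.frequently ?_)
  filter_upwards [mem_nhdsWithin_of_mem_nhds (Ioi_mem_nhds (zero_lt_one (α := ℝ)))] with x hx
  exact hreal x hx

lemma aux_exp_bound (z : ℂ) (hz : z.re ≤ 0) : ‖1 - Complex.exp z‖ ≤ ‖z‖ := by
  have := Convex.norm_image_sub_le_of_norm_deriv_le (f := Complex.exp) (s := {y : ℂ | y.re ≤ 0})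
    (x := z) (y := 0) (C := 1) (fun x _ => Complex.differentiable_exp x)
    (fun x hx => by
      have hx : x.re ≤ 0 := hx
      simpa [Complex.norm_exp] using hx)
    (convex_halfSpace_re_le 0) hz (by simp)
  simpa using this

lemma aux_exp_int (α c θ : ℝ) (hα0 : 0 < α) (hα1 : α < 1) (hc : 0 < c) :
    IntegrableOn (fun t : ℝ => Real.exp (θ * t ^ α) * Real.exp (-(c * t))) (Set.Ioi 0) := by
  refine integrable_of_isBigO_exp_neg (b := c / 2) (by linarith) ?_ ?_
  · apply Continuous.continuousOn
    have := Real.continuous_rpow_const hα0.le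
    fun_prop
  · have h : (fun t : ℝ => t ^ α) =o[Filter.atTop] (fun t : ℝ => t) := by
      refine (Asymptotics.isLittleO_iff_tendsto' ?_).2 ?_
      · filter_upwards [Filter.eventually_gt_atTop 0] with t ht h0
        exact absurd h0 ht.ne'
      · refine (tendsto_rpow_neg_atTop (sub_pos.2 hα1)).congr' ?_
        filter_upwards [Filter.eventually_gt_atTop 0] with t ht
        rw [neg_sub, Real.rpow_sub ht, Real.rpow_one]
    have h2 := (h.const_mul_left θ).bound (c := c / 2) (by linarith)
    apply Asymptotics.IsBigO.of_bound 1
    filter_upwards [h2, Filter.eventually_gt_atTop 0] with t ht ht0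
    rw [Real.norm_of_nonneg (by positivity), Real.norm_of_nonneg (by positivity), one_mul,
      ← Real.exp_add]
    apply Real.exp_le_exp.2
    have := (le_abs_self _).trans ht
    rw [Real.norm_of_nonneg ht0.le] at this
    linarith

/-- The rotated integral. -/
noncomputable def auxH (α φ θ : ℝ) : ℂ :=
  ∫ t in Set.Ioi (0 : ℝ), (1 - Complex.exp (-(((θ * t ^ α : ℝ) : ℂ) * Complex.exp (φ * Complex.I)))) *
    Complex.exp (-(Complex.exp (-(φ * Complex.I)) * t))

lemma aux_hasSum_integral (α φ θ : ℝ) (hα0 : 0 < α) (hα1 : α < 1) (hφ : 0 < Real.cos φ)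
    (hφ0 : 0 < φ) (hφ1 : φ < Real.pi) (hφα : φ * (1 + α) = Real.pi * α)
    (hθ : 0 < θ) :
    HasSum (fun n : ℕ => (-1 : ℝ) ^ n * θ ^ (n + 1) *
      (Real.Gamma (((n : ℝ) + 1) * α + 1) / (Nat.factorial (n + 1) : ℝ)) *
      Real.sin (((n : ℝ) + 1) * Real.pi * α))
      (Complex.exp (-(φ * Complex.I)) * auxH α φ θ).im := by
  set w : ℂ := Complex.exp (φ * Complex.I) with hw
  set r : ℂ := Complex.exp (-(φ * Complex.I)) with hr
  have hrre : r.re = Real.cos φ := by simp [hr, Complex.exp_re]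
  have hwn : ‖w‖ = 1 := by simp [hw, Complex.norm_exp]
  have hse : ∀ z : ℂ, HasSum (fun n : ℕ => z ^ (n + 1) / ((n + 1).factorial : ℂ))
      (Complex.exp z - 1) := by
    intro z
    have := NormedSpace.expSeries_div_hasSum_exp z
    rw [← Complex.exp_eq_exp_ℂ] at this
    have := (hasSum_nat_add_iff' 1).2 this
    simpa using this
  have hseR : ∀ z : ℝ, HasSum (fun n : ℕ => z ^ (n + 1) / ((n + 1).factorial : ℝ))
      (Real.exp z - 1) := by
    intro z
    have := NormedSpace.expSeries_div_hasSum_exp z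
    rw [← Real.exp_eq_exp_ℝ] at this
    have := (hasSum_nat_add_iff' 1).2 this
    simpa using this
  have key : HasSum (fun n : ℕ => ∫ t in Set.Ioi (0 : ℝ),
      -((-(((θ * t ^ α : ℝ) : ℂ) * w)) ^ (n + 1) / ((n + 1).factorial : ℂ)) *
        Complex.exp (-(r * t))) (auxH α φ θ) := by
    refine hasSum_integral_of_dominated_convergence
      (fun n t => (θ * t ^ α) ^ (n + 1) / ((n + 1).factorial : ℝ) * Real.exp (-(Real.cos φ * t)))
      ?_ ?_ ?_ ?_ ?_
    · intro n
      exact (by fun_prop : Measurable _).aestronglyMeasurable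
    · intro n
      filter_upwards [ae_restrict_mem measurableSet_Ioi] with t ht
      have ht : 0 < t := ht
      rw [norm_mul, aux_norm_exp, hrre, norm_neg, norm_div, norm_pow, norm_neg, norm_mul, hwn,
        Complex.norm_real, Real.norm_of_nonneg (by positivity), mul_one, Complex.norm_natCast]
    · exact Filter.Eventually.of_forall fun t => ((hseR _).mul_right _).summable
    · simp_rw [fun t : ℝ => ((hseR (θ * t ^ α)).mul_right (Real.exp (-(Real.cos φ * t)))).tsum_eq,
        sub_mul]
      refine (aux_exp_int α _ θ hα0 hα1 hφ).sub ?_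
      have := aux_int 0 (Real.cos φ) le_rfl hφ
      simpa using this
    · refine Filter.Eventually.of_forall fun t => ?_
      have := ((hse (-(((θ * t ^ α : ℝ) : ℂ) * w))).neg).mul_right (Complex.exp (-(r * t)))
      rwa [neg_sub] at this
  have h2 := Complex.hasSum_im (key.mul_left r)
  convert h2 using 2 with n
  have hint : ∫ t in Set.Ioi (0 : ℝ),
      -((-(((θ * t ^ α : ℝ) : ℂ) * w)) ^ (n + 1) / ((n + 1).factorial : ℂ)) *
        Complex.exp (-(r * t)) = (-((-((θ : ℂ) * w)) ^ (n + 1) / ((n + 1).factorial : ℂ))) *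
        (r ^ (-((((((n : ℝ) + 1) * α : ℝ)) : ℂ) + 1)) *
          (Real.Gamma (((n : ℝ) + 1) * α + 1) : ℂ)) := by
    rw [← gamma_rot (((n : ℝ) + 1) * α) (by positivity) r (by rw [hrre]; exact hφ),
      ← integral_const_mul]
    refine setIntegral_congr_fun measurableSet_Ioi fun t ht => ?_
    have ht : 0 < t := ht
    have : t ^ (((n : ℝ) + 1) * α) = (t ^ α) ^ (n + 1) := by
      rw [mul_comm, Real.rpow_mul ht.le, ← Real.rpow_natCast]; push_cast; rfl
    simp only [this]
    push_cast
    ring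
  rw [hint]
  have hlog : Complex.log r = -(φ * Complex.I) := by
    rw [hr, Complex.log_exp] <;> simp <;> linarith
  have hrp : r ^ (-((((((n : ℝ) + 1) * α : ℝ)) : ℂ) + 1)) =
      Complex.exp ((φ * Complex.I) * ((((((n : ℝ) + 1) * α : ℝ)) : ℂ) + 1)) := by
    rw [Complex.cpow_def_of_ne_zero (Complex.exp_ne_zero _), hlog]
    congr 1; ring
  have hwp : w ^ (n + 1) = Complex.exp (((n + 1 : ℕ) : ℂ) * (φ * Complex.I)) := by
    rw [hw, ← Complex.exp_nat_mul]
  have hprod : r * w ^ (n + 1) * r ^ (-((((((n : ℝ) + 1) * α : ℝ)) : ℂ) + 1)) =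
      Complex.exp (((((n : ℝ) + 1) * Real.pi * α : ℝ) : ℂ) * Complex.I) := by
    rw [hrp, hwp, hr, ← Complex.exp_add, ← Complex.exp_add]
    congr 1
    have : ((n : ℝ) + 1) * Real.pi * α = ((n : ℝ) + 1) * (φ * (1 + α)) := by rw [hφα]; ring
    rw [this]
    push_cast
    ring
  have hfin : r * ((-((-((θ : ℂ) * w)) ^ (n + 1) / ((n + 1).factorial : ℂ))) *
        (r ^ (-((((((n : ℝ) + 1) * α : ℝ)) : ℂ) + 1)) *
          (Real.Gamma (((n : ℝ) + 1) * α + 1) : ℂ))) =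
      (((-1 : ℝ) ^ n * θ ^ (n + 1) *
      (Real.Gamma (((n : ℝ) + 1) * α + 1) / (Nat.factorial (n + 1) : ℝ)) : ℝ) : ℂ) *
      Complex.exp (((((n : ℝ) + 1) * Real.pi * α : ℝ) : ℂ) * Complex.I) := by
    rw [← hprod, neg_pow, mul_pow, pow_succ (-1 : ℂ) n]
    push_cast
    ring
  rw [hfin, Complex.im_ofReal_mul, Complex.exp_ofReal_mul_I_im]

lemma zeta_eq (α φ θ : ℝ) (hα0 : 0 < α) (hα1 : α < 1) (hφ : 0 < Real.cos φ)
    (hφ0 : 0 < φ) (hφ1 : φ < Real.pi) (hφα : φ * (1 + α) = Real.pi * α)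
    (hθ : 0 < θ) :
    zetaFn α θ = (1 / (α * Real.pi)) * θ⁻¹ *
      (Complex.exp (-(φ * Complex.I)) * auxH α φ θ).im := by
  rw [← (aux_hasSum_integral α φ θ hα0 hα1 hφ hφ0 hφ1 hφα hθ).tsum_eq]
  unfold zetaFn wrightFn
  have e : ∀ n : ℕ, (θ ^ (-(1 / α))) ^ (-(α * ((n : ℝ) + 1)) - 1) = θ ^ (1 / α) * θ ^ (n + 1) := by
    intro n
    rw [← Real.rpow_mul hθ.le, ← Real.rpow_natCast, ← Real.rpow_add hθ]
    congr 1
    push_cast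
    field_simp
    ring
  have e2 : θ ^ (-1 - 1 / α) = θ⁻¹ * (θ ^ (1 / α))⁻¹ := by
    rw [sub_eq_add_neg, Real.rpow_add hθ, Real.rpow_neg hθ.le, Real.rpow_neg hθ.le, Real.rpow_one]
  have e3 : (∑' n : ℕ, (-1 : ℝ) ^ n * (θ ^ (-(1 / α))) ^ (-(α * ((n : ℝ) + 1)) - 1) *
      (Real.Gamma (((n : ℝ) + 1) * α + 1) / (Nat.factorial (n + 1) : ℝ)) *
      Real.sin (((n : ℝ) + 1) * Real.pi * α)) = θ ^ (1 / α) * ∑' n : ℕ, (-1 : ℝ) ^ n * θ ^ (n + 1) *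
      (Real.Gamma (((n : ℝ) + 1) * α + 1) / (Nat.factorial (n + 1) : ℝ)) *
      Real.sin (((n : ℝ) + 1) * Real.pi * α) := by
    rw [← tsum_mul_left]
    congr 1
    ext n
    rw [e]
    ring
  rw [e3, e2]
  have : θ ^ (1 / α) ≠ 0 := (Real.rpow_pos_of_pos hθ _).ne'
  field_simp

lemma aux_norm_one_sub (α φ θ t : ℝ) (hφ : 0 < Real.cos φ) (hθ : 0 < θ) (ht : 0 < t) :
    ‖1 - Complex.exp (-(((θ * t ^ α : ℝ) : ℂ) * Complex.exp (φ * Complex.I)))‖ ≤ θ * t ^ α := by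
  have h : 0 < θ * t ^ α := by positivity
  refine (aux_exp_bound _ ?_).trans ?_
  · rw [Complex.neg_re, Complex.re_ofReal_mul, Complex.exp_ofReal_mul_I_re]
    have := mul_pos h hφ
    linarith
  · rw [norm_neg, norm_mul, Complex.norm_exp_ofReal_mul_I, Complex.norm_real,
      Real.norm_of_nonneg h.le, mul_one]

lemma aux_r_re (φ : ℝ) : (Complex.exp (-(φ * Complex.I))).re = Real.cos φ := by
  simp [Complex.exp_re]

lemma aux_r_norm (φ : ℝ) : ‖Complex.exp (-(φ * Complex.I))‖ = 1 := by
  simp [Complex.norm_exp]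

lemma bound_small (α φ θ : ℝ) (hα0 : 0 < α) (hφ : 0 < Real.cos φ) (hθ : 0 < θ) :
    |(Complex.exp (-(φ * Complex.I)) * auxH α φ θ).im| ≤
      θ * ∫ t in Set.Ioi (0 : ℝ), t ^ α * Real.exp (-(Real.cos φ * t)) := by
  refine (Complex.abs_im_le_norm _).trans ?_
  rw [norm_mul, aux_r_norm, one_mul, ← integral_const_mul]
  refine norm_integral_le_of_norm_le ((aux_int α _ hα0.le hφ).const_mul θ) ?_
  filter_upwards [ae_restrict_mem measurableSet_Ioi] with t ht
  rw [norm_mul, aux_norm_exp, aux_r_re, ← mul_assoc]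
  gcongr
  exact aux_norm_one_sub α φ θ t hφ hθ ht

lemma bound_large (α φ θ : ℝ) (hα0 : 0 < α) (hφ : 0 < Real.cos φ) (hθ : 0 < θ) :
    |(Complex.exp (-(φ * Complex.I)) * auxH α φ θ).im| ≤
      (Real.cos φ) ^ (-1 / α) * Real.Gamma (1 / α + 1) * θ ^ (-1 / α) := by
  set r := Complex.exp (-(φ * Complex.I)) with hr
  have i1 : IntegrableOn (fun t : ℝ => Complex.exp (-(r * t))) (Set.Ioi 0) := by
    have := aux_int 0 _ le_rfl hφ
    refine this.mono' ((by fun_prop : Measurable _).aestronglyMeasurable) ?_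
    refine Filter.Eventually.of_forall fun t => ?_
    rw [aux_norm_exp, hr, aux_r_re]; simp
  have hb : ∀ t : ℝ, 0 < t → ‖Complex.exp (-(((θ * t ^ α : ℝ) : ℂ) * Complex.exp (φ * Complex.I))) *
      Complex.exp (-(r * t))‖ ≤ Real.exp (-(Real.cos φ * θ) * t ^ α) := by
    intro t ht
    rw [norm_mul, aux_norm_exp, hr, aux_r_re, Complex.norm_exp, ← Real.exp_add, Real.exp_le_exp,
      Complex.neg_re, Complex.re_ofReal_mul, Complex.exp_ofReal_mul_I_re]
    have := mul_pos hφ ht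
    linarith
  have i0 : IntegrableOn (fun t : ℝ => Real.exp (-(Real.cos φ * θ) * t ^ α)) (Set.Ioi 0) := by
    have := integrableOn_rpow_mul_exp_neg_mul_rpow (p := α) (s := 0) (b := Real.cos φ * θ)
      (by norm_num) hα0 (by positivity)
    simpa using this
  have hb' : ∀ᵐ t ∂(volume.restrict (Set.Ioi (0 : ℝ))),
      ‖Complex.exp (-(((θ * t ^ α : ℝ) : ℂ) * Complex.exp (φ * Complex.I))) *
      Complex.exp (-(r * t))‖ ≤ Real.exp (-(Real.cos φ * θ) * t ^ α) := by
    filter_upwards [ae_restrict_mem measurableSet_Ioi] with t ht using hb t ht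
  have i2 : IntegrableOn (fun t : ℝ => Complex.exp (-(((θ * t ^ α : ℝ) : ℂ) *
      Complex.exp (φ * Complex.I))) * Complex.exp (-(r * t))) (Set.Ioi 0) :=
    i0.mono' ((by fun_prop : Measurable _).aestronglyMeasurable) hb'
  have g0 : ∫ t in Set.Ioi (0 : ℝ), Complex.exp (-(r * t)) = r⁻¹ := by
    have := gamma_rot 0 le_rfl r (by rw [hr, aux_r_re]; exact hφ)
    simpa [Complex.cpow_neg_one] using this
  have hH : r * auxH α φ θ = 1 - r * ∫ t in Set.Ioi (0 : ℝ), Complex.exp (-(((θ * t ^ α : ℝ) : ℂ) *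
      Complex.exp (φ * Complex.I))) * Complex.exp (-(r * t)) := by
    unfold auxH
    simp_rw [sub_mul, one_mul, ← hr]
    rw [integral_sub i1 i2, g0, mul_sub, mul_inv_cancel₀ (Complex.exp_ne_zero _)]
  rw [hH, Complex.sub_im, Complex.one_im, zero_sub, abs_neg]
  refine (Complex.abs_im_le_norm _).trans ?_
  rw [norm_mul, hr, aux_r_norm, one_mul, ← hr]
  refine (norm_integral_le_of_norm_le i0 hb').trans (le_of_eq ?_)
  rw [integral_exp_neg_mul_rpow hα0 (by positivity), Real.mul_rpow hφ.le hθ.le]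
  ring

lemma auxH_meas (α φ : ℝ) : Measurable (auxH α φ) := by
  unfold auxH
  apply StronglyMeasurable.measurable
  apply StronglyMeasurable.integral_prod_right
  apply Measurable.stronglyMeasurable
  unfold Function.uncurry
  fun_prop

lemma aux_integrable (g : ℝ → ℝ) (α C₁ C₂ : ℝ) (hα0 : 0 < α) (hα1 : α < 1)
    (hg : AEStronglyMeasurable g (volume.restrict (Set.Ioi 0)))
    (h1 : ∀ θ, 0 < θ → θ ≤ 1 → |g θ| ≤ C₁) (h2 : ∀ θ, 1 < θ → |g θ| ≤ C₂ * θ ^ (-1 / α)) :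
    IntegrableOn g (Set.Ioi 0) := by
  rw [← Set.Ioc_union_Ioi_eq_Ioi (zero_le_one (α := ℝ))]
  refine IntegrableOn.union ?_ ?_
  · refine IntegrableOn.of_bound (by simp) (hg.mono_set Set.Ioc_subset_Ioi_self) C₁ ?_
    filter_upwards [ae_restrict_mem measurableSet_Ioc] with t ht using h1 t ht.1 ht.2
  · have : -1 / α < -1 := by rw [div_lt_iff₀ hα0]; linarith
    refine Integrable.mono' ((integrableOn_Ioi_rpow_of_lt this one_pos).const_mul C₂)
      (hg.mono_set (Set.Ioi_subset_Ioi zero_le_one)) ?_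
    filter_upwards [ae_restrict_mem measurableSet_Ioi] with t ht using h2 t ht

lemma zeta_integrable (α : ℝ) (hα0 : 0 < α) (hα1 : α < 1) :
    IntegrableOn (zetaFn α) (Set.Ioi 0) ∧ IntegrableOn (fun θ => θ * zetaFn α θ) (Set.Ioi 0) := by
  obtain ⟨φ, hφdef⟩ : ∃ φ, φ = Real.pi * α / (1 + α) := ⟨_, rfl⟩
  have hpi := Real.pi_pos
  have hφα : φ * (1 + α) = Real.pi * α := by rw [hφdef]; field_simp
  have hφ0 : 0 < φ := by rw [hφdef]; positivity
  have hφ2 : φ < Real.pi / 2 := by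
    rw [hφdef, div_lt_iff₀ (by linarith)]; nlinarith
  have hφ : 0 < Real.cos φ := Real.cos_pos_of_mem_Ioo ⟨by linarith, hφ2⟩
  have hz : ∀ θ, 0 < θ → zetaFn α θ = (1 / (α * Real.pi)) * θ⁻¹ *
      (Complex.exp (-(φ * Complex.I)) * auxH α φ θ).im := fun θ hθ =>
    zeta_eq α φ θ hα0 hα1 hφ hφ0 (by linarith) hφα hθ
  have hmeas : AEStronglyMeasurable (zetaFn α) (volume.restrict (Set.Ioi 0)) := by
    have hm := auxH_meas α φ
    have : Measurable fun θ : ℝ => (1 / (α * Real.pi)) * θ⁻¹ *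
      (Complex.exp (-(φ * Complex.I)) * auxH α φ θ).im := by fun_prop
    refine this.aestronglyMeasurable.congr ?_
    filter_upwards [ae_restrict_mem measurableSet_Ioi] with t ht using (hz t ht).symm
  set A := ∫ t in Set.Ioi (0 : ℝ), t ^ α * Real.exp (-(Real.cos φ * t)) with hA
  set B := (Real.cos φ) ^ (-1 / α) * Real.Gamma (1 / α + 1) with hB
  have hB0 : 0 < B := by
    have := Real.Gamma_pos_of_pos (show 0 < 1 / α + 1 by positivity)
    positivity
  have habs : ∀ θ, 0 < θ → θ * |zetaFn α θ| = (1 / (α * Real.pi)) *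
      |(Complex.exp (-(φ * Complex.I)) * auxH α φ θ).im| := by
    intro θ hθ
    rw [hz θ hθ, abs_mul, abs_of_pos (show 0 < 1 / (α * Real.pi) * θ⁻¹ by positivity)]
    field_simp
  have b1 : ∀ θ, 0 < θ → |zetaFn α θ| ≤ 1 / (α * Real.pi) * A := by
    intro θ hθ
    refine le_of_mul_le_mul_left ?_ hθ
    rw [habs θ hθ]
    calc _ ≤ 1 / (α * Real.pi) * (θ * A) := by gcongr; exact bound_small α φ θ hα0 hφ hθ
      _ = _ := by ring
  have b2 : ∀ θ, 0 < θ → θ * |zetaFn α θ| ≤ (1 / (α * Real.pi) * B) * θ ^ (-1 / α) := by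
    intro θ hθ
    rw [habs θ hθ, mul_assoc]
    gcongr
    exact bound_large α φ θ hα0 hφ hθ
  constructor
  · refine aux_integrable _ α _ (1 / (α * Real.pi) * B) hα0 hα1 hmeas (fun θ h _ => b1 θ h) fun θ h => ?_
    · refine le_trans ?_ (b2 θ (by linarith))
      exact le_mul_of_one_le_left (abs_nonneg _) h.le
  · refine aux_integrable _ α (1 / (α * Real.pi) * A) (1 / (α * Real.pi) * B) hα0 hα1
      (measurable_id.aestronglyMeasurable.mul hmeas) (fun θ h h1 => ?_) fun θ h => ?_
    · rw [abs_mul, abs_of_pos h]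
      exact (mul_le_of_le_one_left (abs_nonneg _) h1).trans (b1 θ h)
    · rw [abs_mul, abs_of_pos (by linarith)]
      exact b2 θ (by linarith)

theorem compactness_of_S_and_T
    {X Y : Type*} [NormedAddCommGroup X] [NormedSpace ℝ X] [CompleteSpace X]
    [NormedAddCommGroup Y] [NormedSpace ℝ Y] [CompleteSpace Y]
    (Linv : Y →L[ℝ] X) (hLinv : IsCompactOperator (⇑Linv))
    (Q : ℝ → Y →L[ℝ] Y) (M₀ : ℝ) (hQ : ∀ t, 0 ≤ t → ‖Q t‖ ≤ M₀)
    (hQcont : ∀ u : Y, ContinuousOn (fun t => Q t u) (Set.Ici 0))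
    (α : ℝ) (hα0 : 0 < α) (hα1 : α < 1) :
    ∀ t : ℝ, 0 ≤ t →
      IsCompactOperator
        (fun u : Y => ∫ θ in Set.Ioi (0 : ℝ), zetaFn α θ • Linv (Q (t ^ α * θ) u)) ∧
      IsCompactOperator
        (fun u : Y => α • ∫ θ in Set.Ioi (0 : ℝ), (θ * zetaFn α θ) • Linv (Q (t ^ α * θ) u)) := by
  intro t ht
  obtain ⟨h1, h2⟩ := zeta_integrable α hα0 hα1
  have hs : 0 ≤ t ^ α := Real.rpow_nonneg ht α
  exact ⟨aux_compact Linv hLinv Q M₀ hQ _ h1 _ hs,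
    (aux_compact Linv hLinv Q M₀ hQ _ h2 _ hs).smul α⟩
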